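/- Let a > −1, b > −1, c > max{0, a−b} be real numbers and k a nonnegative integer. Then ∫_0^∞ x^k P_{2k}^{(0)}(x; a, b, c) W(x; a, b, c) dx = (2k)! (a+1)_{2k} (b+1)_{2k} / (c+b+1)_{3k}, and ∫_0^∞ x^k P_{2k}^{(1)}(x; a, b, c) W(x; a, b, c+1) dx = (2k)! (a+1)_{2k} (b+1)_{2k} (c+b−a+1)_k (c+1)_k (c+b+1)_k / ( (c+b+1)_{3k} (c+b+2)_{3k} ). In particular both integrals are strictly positive. -/

import Mathlib

open MeasureTheory Filter Set

/-- Pochhammer symbol `(z)_k = z (z+1) ⋯ (z+k-1)`. -/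
noncomputable def poch (z : ℝ) (k : ℕ) : ℝ := ∏ i ∈ Finset.range k, (z + i)

/-- Confluent hypergeometric function of the second kind (Tricomi function),
via its integral representation, valid for `α > 0`, `x > 0`. -/
noncomputable def TricomiU (α β x : ℝ) : ℝ :=
  (1 / Real.Gamma α) *
    ∫ t in Set.Ioi (0:ℝ), t ^ (α - 1) * (1 + t) ^ (β - α - 1) * Real.exp (-t * x)

/-- The weight function `W(x; a, b, c)`. -/
noncomputable def W (a b c x : ℝ) : ℝ :=
  (Real.Gamma (c + b + 1) / (Real.Gamma (a + 1) * Real.Gamma (b + 1))) *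
    Real.exp (-x) * x ^ a * TricomiU c (a - b + 1) x

/-- The monic type II multiple orthogonal polynomial on the step line:
`P_n^{(d)}(x; a, b, c) = Σ_{j=0}^n (−1)^{n−j} C(n,j)
  ((a+1+j)_{n−j}(b+1+j)_{n−j}/(c+b+1+⌊(n+d)/2⌋+j)_{n−j}) x^j`. -/
noncomputable def Ptype2 (d : ℕ) (a b c : ℝ) (n : ℕ) (x : ℝ) : ℝ :=
  ∑ j ∈ Finset.range (n + 1),
    (-1 : ℝ) ^ (n - j) * (n.choose j : ℝ) *
      (poch (a + 1 + j) (n - j) * poch (b + 1 + j) (n - j) /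
        poch (c + b + 1 + (((n + d) / 2 : ℕ) : ℝ) + j) (n - j)) * x ^ j

open Function in
lemma aux_swap (f : ℝ → ℝ → ℝ) (hm : Measurable (uncurry f))
    (h0 : ∀ x > 0, ∀ t > 0, 0 ≤ f x t)
    (h1 : ∀ t > 0, IntegrableOn (fun x => f x t) (Ioi 0))
    (h2 : IntegrableOn (fun t => ∫ x in Ioi (0:ℝ), f x t) (Ioi 0)) :
    IntegrableOn (fun x => ∫ t in Ioi (0:ℝ), f x t) (Ioi 0) ∧
    ∫ x in Ioi (0:ℝ), ∫ t in Ioi (0:ℝ), f x t = ∫ t in Ioi (0:ℝ), ∫ x in Ioi (0:ℝ), f x t := by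
  have key : Integrable (uncurry f)
      ((volume.restrict (Ioi (0:ℝ))).prod (volume.restrict (Ioi (0:ℝ)))) := by
    rw [integrable_prod_iff' hm.aestronglyMeasurable]
    constructor
    · filter_upwards [ae_restrict_mem measurableSet_Ioi] with t ht
      exact h1 t ht
    · refine IntegrableOn.congr_fun h2 (fun t ht => ?_) measurableSet_Ioi
      refine setIntegral_congr_fun measurableSet_Ioi (fun x hx => ?_)
      simp only [uncurry]
      rw [Real.norm_of_nonneg (h0 x hx t ht)]
  exact ⟨key.integral_prod_left, integral_integral_swap key⟩

lemma aux_gamma (p r : ℝ) (hp : 0 < p) (hr : 0 < r) :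
    IntegrableOn (fun x : ℝ => x ^ (p - 1) * Real.exp (-(r * x))) (Ioi 0) := by
  refine Integrable.of_integral_ne_zero ?_
  rw [Real.integral_rpow_mul_exp_neg_mul_Ioi hp hr]
  have := Real.Gamma_pos_of_pos hp
  positivity

lemma aux_beta (c d : ℝ) (hc : 0 < c) (hd : 0 < d) :
    IntegrableOn (fun t : ℝ => t ^ (c - 1) * (1 / (1 + t)) ^ (c + d)) (Ioi 0) ∧
    ∫ t in Ioi (0:ℝ), t ^ (c - 1) * (1 / (1 + t)) ^ (c + d)
      = Real.Gamma c * Real.Gamma d / Real.Gamma (c + d) := by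
  have hG := Real.Gamma_pos_of_pos (add_pos hc hd)
  have e1 : ∀ y ∈ Ioi (0:ℝ), (∫ t in Ioi (0:ℝ), t ^ (c - 1) * y ^ (c + d - 1) *
      Real.exp (-((1 + t) * y))) = y ^ (d - 1) * Real.exp (-(1 * y)) * Real.Gamma c := by
    intro y hy
    have hy : 0 < y := hy
    have : ∀ t : ℝ, t ^ (c - 1) * y ^ (c + d - 1) * Real.exp (-((1 + t) * y)) =
        (y ^ (c + d - 1) * Real.exp (-(1 * y))) * (t ^ (c - 1) * Real.exp (-(y * t))) := by
      intro t
      rw [show -((1 + t) * y) = -(1 * y) + -(y * t) by ring, Real.exp_add]; ring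
    simp_rw [this]
    rw [integral_const_mul, Real.integral_rpow_mul_exp_neg_mul_Ioi hc hy]
    rw [show c + d - 1 = (d - 1) + c by ring, Real.rpow_add hy, one_div, Real.inv_rpow hy.le]
    have := (Real.rpow_pos_of_pos hy c).ne'
    field_simp
  have e2 : ∀ t ∈ Ioi (0:ℝ), (∫ y in Ioi (0:ℝ), t ^ (c - 1) * y ^ (c + d - 1) *
      Real.exp (-((1 + t) * y))) =
      Real.Gamma (c + d) * (t ^ (c - 1) * (1 / (1 + t)) ^ (c + d)) := by
    intro t ht
    have ht : 0 < t := ht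
    simp_rw [mul_assoc]
    rw [integral_const_mul]
    rw [Real.integral_rpow_mul_exp_neg_mul_Ioi (add_pos hc hd) (by linarith)]
    ring
  obtain ⟨i1, i2⟩ := aux_swap (fun t y => t ^ (c - 1) * y ^ (c + d - 1) *
      Real.exp (-((1 + t) * y))) (by unfold Function.uncurry; fun_prop)
      (fun t ht y hy => by
        have : 0 < t := ht
        have : 0 < y := hy
        positivity)
      (fun y hy => by
        refine IntegrableOn.congr_fun (((aux_gamma c y hc hy).const_mul
          (y ^ (c + d - 1) * Real.exp (-(1 * y))))) (fun t _ => ?_) measurableSet_Ioi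
        rw [show -((1 + t) * y) = -(1 * y) + -(y * t) by ring, Real.exp_add]; ring)
      (IntegrableOn.congr_fun ((aux_gamma d 1 hd one_pos).mul_const (Real.Gamma c))
        (fun y hy => (e1 y hy).symm) measurableSet_Ioi)
  have i1' := IntegrableOn.congr_fun i1 e2 measurableSet_Ioi
  constructor
  · have := i1'.const_mul (Real.Gamma (c + d))⁻¹
    refine IntegrableOn.congr_fun this (fun t _ => ?_) measurableSet_Ioi
    field_simp
  · rw [setIntegral_congr_fun measurableSet_Ioi e2, setIntegral_congr_fun measurableSet_Ioi e1,
      integral_const_mul, integral_mul_const,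
      Real.integral_rpow_mul_exp_neg_mul_Ioi hd one_pos] at i2
    rw [eq_div_iff hG.ne', mul_comm, i2]
    simp [mul_comm]

lemma aux_poch_gamma (z : ℝ) (hz : 0 < z) (m : ℕ) :
    Real.Gamma (z + m) = poch z m * Real.Gamma z := by
  induction m with
  | zero => simp [poch]
  | succ m ih =>
    rw [Nat.cast_succ, ← add_assoc, Real.Gamma_add_one (by positivity), ih]
    simp only [poch, Finset.prod_range_succ]; ring

lemma aux_poch_pos (z : ℝ) (hz : 0 < z) (m : ℕ) : 0 < poch z m :=
  Finset.prod_pos fun i _ => by positivity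

lemma aux_poch_add (z : ℝ) (m n : ℕ) : poch z (m + n) = poch z m * poch (z + m) n := by
  simp only [poch, Finset.prod_range_add]
  congr 1
  refine Finset.prod_congr rfl fun i _ => ?_
  push_cast; ring

lemma aux_moment (a b c : ℝ) (ha : a > -1) (hb : b > -1) (hc : 0 < c) (m : ℕ) :
    IntegrableOn (fun x : ℝ => x ^ m * W a b c x) (Ioi 0) ∧
    ∫ x in Ioi (0:ℝ), x ^ m * W a b c x
      = poch (a + 1) m * poch (b + 1) m / poch (c + b + 1) m := by
  have hA : 0 < a + 1 + m := by have : (0:ℝ) ≤ m := m.cast_nonneg; linarith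
  have hB : 0 < b + 1 + m := by have : (0:ℝ) ≤ m := m.cast_nonneg; linarith
  obtain ⟨b1, b2⟩ := aux_beta c (b + 1 + m) hc hB
  set f : ℝ → ℝ → ℝ := fun x t => x ^ (a + 1 + m - 1) * Real.exp (-x) *
    (t ^ (c - 1) * (1 + t) ^ (a - b + 1 - c - 1) * Real.exp (-t * x)) with hf
  have e0 : ∀ t x : ℝ, f x t = (t ^ (c - 1) * (1 + t) ^ (a - b + 1 - c - 1)) *
      (x ^ (a + 1 + m - 1) * Real.exp (-((1 + t) * x))) := by
    intro t x
    rw [hf, show -((1 + t) * x) = -x + -t * x by ring, Real.exp_add]; ring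
  have e1 : ∀ t ∈ Ioi (0:ℝ), (∫ x in Ioi (0:ℝ), f x t) =
      Real.Gamma (a + 1 + m) * (t ^ (c - 1) * (1 / (1 + t)) ^ (c + (b + 1 + m))) := by
    intro t ht
    have ht : 0 < 1 + t := by have : 0 < t := ht; linarith
    simp_rw [e0]
    rw [integral_const_mul, Real.integral_rpow_mul_exp_neg_mul_Ioi hA ht]
    have : (1 / (1 + t)) ^ (c + (b + 1 + m)) =
        (1 + t) ^ (a - b + 1 - c - 1) * (1 / (1 + t)) ^ (a + 1 + m) := by
      rw [one_div, Real.inv_rpow ht.le, Real.inv_rpow ht.le, ← Real.rpow_neg ht.le,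
        ← Real.rpow_neg ht.le, ← Real.rpow_add ht]
      congr 1; ring
    rw [this]; ring
  obtain ⟨i1, i2⟩ := aux_swap f (by rw [hf]; unfold Function.uncurry; fun_prop)
    (fun x hx t ht => by
      have : 0 < t := ht
      have : 0 < x := hx
      simp only [hf]
      positivity)
    (fun t ht => by
      have ht : 0 < 1 + t := by have : 0 < t := ht; linarith
      simp_rw [e0]
      exact (aux_gamma _ _ hA ht).const_mul _)
    (IntegrableOn.congr_fun (b1.const_mul _) (fun t ht => (e1 t ht).symm) measurableSet_Ioi)
  have e2 : ∀ x ∈ Ioi (0:ℝ), (Real.Gamma (c + b + 1) / (Real.Gamma (a + 1) * Real.Gamma (b + 1))) *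
      (1 / Real.Gamma c) * (∫ t in Ioi (0:ℝ), f x t) = x ^ m * W a b c x := by
    intro x hx
    have hx : 0 < x := hx
    simp only [hf, W, TricomiU]
    rw [integral_const_mul, show a + 1 + m - 1 = a + m by ring, Real.rpow_add hx,
      Real.rpow_natCast]
    ring
  refine ⟨IntegrableOn.congr_fun (i1.const_mul _) e2 measurableSet_Ioi, ?_⟩
  rw [← setIntegral_congr_fun measurableSet_Ioi e2, integral_const_mul, i2,
    setIntegral_congr_fun measurableSet_Ioi e1, integral_const_mul, b2,
    show c + (b + 1 + m) = c + b + 1 + m by ring,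
    aux_poch_gamma _ (by linarith), aux_poch_gamma _ (by linarith), aux_poch_gamma _ (by linarith)]
  have := (Real.Gamma_pos_of_pos (show 0 < a + 1 by linarith)).ne'
  have := (Real.Gamma_pos_of_pos (show 0 < b + 1 by linarith)).ne'
  have := (Real.Gamma_pos_of_pos (show 0 < c + b + 1 by linarith)).ne'
  have := (Real.Gamma_pos_of_pos hc).ne'
  have := (aux_poch_pos (c + b + 1) (by linarith) m).ne'
  field_simp

/-- the integral as a finite sum -/
lemma aux_sum (d : ℕ) (a b c c' : ℝ) (ha : a > -1) (hb : b > -1) (hc : 0 < c') (k n : ℕ) :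
    ∫ x in Ioi (0:ℝ), x ^ k * Ptype2 d a b c n x * W a b c' x
    = ∑ j ∈ Finset.range (n + 1), (-1 : ℝ) ^ (n - j) * (n.choose j : ℝ) *
      (poch (a + 1 + j) (n - j) * poch (b + 1 + j) (n - j) /
        poch (c + b + 1 + (((n + d) / 2 : ℕ) : ℝ) + j) (n - j)) *
      (poch (a + 1) (k + j) * poch (b + 1) (k + j) / poch (c' + b + 1) (k + j)) := by
  have : ∀ x : ℝ, x ^ k * Ptype2 d a b c n x * W a b c' x =
      ∑ j ∈ Finset.range (n + 1), (-1 : ℝ) ^ (n - j) * (n.choose j : ℝ) *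
      (poch (a + 1 + j) (n - j) * poch (b + 1 + j) (n - j) /
        poch (c + b + 1 + (((n + d) / 2 : ℕ) : ℝ) + j) (n - j)) *
      (x ^ (k + j) * W a b c' x) := by
    intro x
    rw [Ptype2, Finset.mul_sum, Finset.sum_mul]
    refine Finset.sum_congr rfl fun j _ => ?_
    rw [pow_add]; ring
  simp_rw [this]
  rw [integral_finsetSum _ fun j _ => (aux_moment a b c' ha hb hc (k + j)).1.const_mul _]
  refine Finset.sum_congr rfl fun j _ => ?_
  rw [integral_const_mul, (aux_moment a b c' ha hb hc (k + j)).2]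

open Polynomial in
/-- the polynomial `(X + z)_k` -/
noncomputable def auxP (z : ℝ) (k : ℕ) : ℝ[X] := ∏ i ∈ Finset.range k, (X + C (z + i))

open Polynomial

lemma auxP_eval (z : ℝ) (k : ℕ) (x : ℝ) : (auxP z k).eval x = poch (z + x) k := by
  simp only [auxP, poch, eval_prod, eval_add, eval_X, eval_C]
  exact Finset.prod_congr rfl fun i _ => by ring

lemma auxP_monic (z : ℝ) (k : ℕ) : (auxP z k).Monic :=
  monic_prod_of_monic _ _ fun _ _ => monic_X_add_C _

lemma auxP_deg (z : ℝ) (k : ℕ) : (auxP z k).natDegree = k := by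
  rw [auxP, natDegree_prod_of_monic _ _ fun i _ => monic_X_add_C _]
  simp only [natDegree_X_add_C]; simp

lemma aux_D (f : ℝ → ℝ) (n : ℕ) (y : ℝ) :
    ∑ j ∈ Finset.range (n + 1), (-1 : ℝ) ^ (n - j) * (n.choose j : ℝ) * f (y + j)
      = (fwdDiff (1:ℝ))^[n] f y := by
  rw [fwdDiff_iter_eq_sum_shift]
  refine Finset.sum_congr rfl fun j _ => ?_
  simp [zsmul_eq_mul]

lemma aux_inv (n : ℕ) : ∀ z : ℝ, 0 < z →
    (fwdDiff (1:ℝ))^[n] (fun x => x⁻¹) z = (-1) ^ n * n.factorial / poch z (n + 1) := by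
  induction n with
  | zero => intro z hz; simp [poch]
  | succ n ih =>
    intro z hz
    rw [Function.iterate_succ_apply', fwdDiff, ih z hz, ih (z + 1) (by linarith)]
    have h1 : poch z (n + 1 + 1) = poch z (n + 1) * (z + (n + 1)) := by
      simp [poch, Finset.prod_range_succ]
    have h2 : poch z (n + 1 + 1) = z * poch (z + 1) (n + 1) := by
      rw [add_comm (n + 1) 1, aux_poch_add]; simp [poch]
    have p1 := (aux_poch_pos z hz (n + 1)).ne'
    have p2 := (aux_poch_pos (z + 1) (by linarith) (n + 1)).ne'
    have p3 : z + (n + 1) ≠ 0 := by positivity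
    have h3 : poch (z + 1) (n + 1) = poch z (n + 1) * (z + (n + 1)) / z := by
      rw [eq_div_iff hz.ne', ← h1, h2]; ring
    rw [h3, h1, Nat.factorial_succ]
    push_cast
    field_simp
    ring

lemma aux_Q_sum (Q : ℝ[X]) (hQ : Q.Monic) :
    ∑ j ∈ Finset.range (Q.natDegree + 1), (-1 : ℝ) ^ (Q.natDegree - j) *
      (Q.natDegree.choose j : ℝ) * Q.eval (j : ℝ) = Q.natDegree.factorial := by
  have := aux_D (fun x => Q.eval x) Q.natDegree 0
  simp only [zero_add] at this
  rw [this, Polynomial.fwdDiff_iter_degree_eq_factorial, hQ.leadingCoeff]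
  simp

lemma aux_Q_inv (Q : ℝ[X]) (hQ : Q.Monic) (z : ℝ) (hz : 0 < z) :
    ∑ j ∈ Finset.range (Q.natDegree + 1), (-1 : ℝ) ^ (Q.natDegree - j) *
      (Q.natDegree.choose j : ℝ) * (Q.eval (j : ℝ) / (z + j)) =
      Q.eval (-z) * ((-1) ^ Q.natDegree * Q.natDegree.factorial / poch z (Q.natDegree + 1)) := by
  set n := Q.natDegree with hn
  set R := Q /ₘ (X - C (-z)) with hR
  have h1 : ∀ x : ℝ, Q.eval x = Q.eval (-z) + (z + x) * R.eval x := by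
    intro x
    have := congrArg (eval x) (modByMonic_add_div Q (X - C (-z)))
    rw [modByMonic_X_sub_C_eq_C_eval] at this
    rw [← this]
    rw [← hR]
    simp only [eval_add, eval_C, eval_mul, eval_sub, eval_X]; ring
  have h2 : ∑ j ∈ Finset.range (n + 1), (-1 : ℝ) ^ (n - j) * (n.choose j : ℝ) * R.eval (j : ℝ)
      = 0 := by
    rcases Nat.eq_zero_or_pos n with h | h
    · have : R = 0 := by
        rw [hR, divByMonic_eq_zero_iff (monic_X_sub_C _), degree_X_sub_C,
          degree_eq_natDegree hQ.ne_zero, ← hn, h]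
        simp
      simp [this]
    · have := aux_D (fun x => R.eval x) n 0
      simp only [zero_add] at this
      rw [this, Polynomial.fwdDiff_iter_eq_zero_of_degree_lt]
      · simp
      · rw [hR, natDegree_divByMonic _ (monic_X_sub_C _), natDegree_X_sub_C]; omega
  have h3 := aux_D (fun x => x⁻¹) n z
  rw [aux_inv n z hz] at h3
  rw [← h3, ← add_zero (eval (-z) Q * _), ← h2, Finset.mul_sum, ← Finset.sum_add_distrib]
  refine Finset.sum_congr rfl fun j _ => ?_
  rw [h1 j]
  have : z + (j:ℝ) ≠ 0 := by positivity
  field_simp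

lemma aux_reflect (u : ℝ) (k : ℕ) : poch (1 - u - k) k = (-1) ^ k * poch u k := by
  rw [poch, poch, ← Finset.prod_range_reflect, ← Finset.card_range k, ← Finset.prod_const,
    Finset.card_range, ← Finset.prod_mul_distrib]
  refine Finset.prod_congr rfl fun i hi => ?_
  have : i + 1 ≤ k := Finset.mem_range.1 hi
  rw [Nat.sub_sub, Nat.cast_sub (by omega)]
  push_cast; ring

lemma aux_combine (z : ℝ) (k n j : ℕ) (hj : j ≤ n) :
    poch (z + j) (n - j) * poch z (k + j) = poch z n * poch (z + j) k := by
  have h1 := aux_poch_add z j (n - j)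
  rw [Nat.add_sub_cancel' hj] at h1
  rw [h1, add_comm k j, aux_poch_add]; ring

lemma aux_even (a b c : ℝ) (ha : a > -1) (hb : b > -1) (hc : 0 < c) (k : ℕ) :
    ∫ x in Set.Ioi (0:ℝ), x ^ k * Ptype2 0 a b c (2 * k) x * W a b c x
      = (2 * k).factorial * poch (a + 1) (2 * k) * poch (b + 1) (2 * k) /
          poch (c + b + 1) (3 * k) := by
  rw [aux_sum 0 a b c c ha hb hc]
  have hQ := (auxP_monic (a + 1) k).mul (auxP_monic (b + 1) k)
  have hd : (auxP (a + 1) k * auxP (b + 1) k).natDegree = 2 * k := by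
    rw [(auxP_monic (a + 1) k).natDegree_mul (auxP_monic (b + 1) k), auxP_deg, auxP_deg]; ring
  have h := aux_Q_sum _ hQ
  rw [hd] at h
  rw [← h, Finset.sum_mul, Finset.sum_mul, Finset.sum_div]
  refine Finset.sum_congr rfl fun j hj => ?_
  have hj : j ≤ 2 * k := Nat.lt_succ_iff.1 (Finset.mem_range.1 hj)
  have hA := aux_combine (a + 1) k (2 * k) j hj
  have hB := aux_combine (b + 1) k (2 * k) j hj
  have hC := aux_poch_add (c + b + 1) (k + j) (2 * k - j)
  rw [show k + j + (2 * k - j) = 3 * k by omega] at hC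
  push_cast at hC
  rw [← add_assoc] at hC
  rw [show (2 * k + 0) / 2 = k by omega, eval_mul, auxP_eval, auxP_eval, hC]
  calc _ = (-1 : ℝ) ^ (2 * k - j) * ((2 * k).choose j : ℝ) *
        ((poch (a + 1 + j) (2 * k - j) * poch (a + 1) (k + j)) *
          (poch (b + 1 + j) (2 * k - j) * poch (b + 1) (k + j))) /
        (poch (c + b + 1) (k + j) * poch (c + b + 1 + k + j) (2 * k - j)) := by
        rw [mul_assoc, div_mul_div_comm, mul_div_assoc]
        rw [mul_comm (poch (c + b + 1 + k + j) (2 * k - j))]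
        ring
    _ = _ := by rw [hA, hB]; congr 1; ring

lemma aux_odd (a b c : ℝ) (ha : a > -1) (hb : b > -1) (hc : 0 < c) (k : ℕ) :
    ∫ x in Set.Ioi (0:ℝ), x ^ k * Ptype2 1 a b c (2 * k) x * W a b (c + 1) x
      = (2 * k).factorial * poch (a + 1) (2 * k) * poch (b + 1) (2 * k) *
          poch (c + b - a + 1) k * poch (c + 1) k * poch (c + b + 1) k /
          (poch (c + b + 1) (3 * k) * poch (c + b + 2) (3 * k)) := by
  rw [aux_sum 1 a b c (c + 1) ha hb (by linarith)]
  have hQ := (auxP_monic (a + 1) k).mul (auxP_monic (b + 1) k)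
  have hd : (auxP (a + 1) k * auxP (b + 1) k).natDegree = 2 * k := by
    rw [(auxP_monic (a + 1) k).natDegree_mul (auxP_monic (b + 1) k), auxP_deg, auxP_deg]; ring
  have hs : 0 < c + b + 1 := by linarith
  have h := aux_Q_inv _ hQ (c + b + 1 + k) (by positivity)
  rw [hd] at h
  have hv : (auxP (a + 1) k * auxP (b + 1) k).eval (-(c + b + 1 + k)) =
      poch (c + b - a + 1) k * poch (c + 1) k := by
    rw [eval_mul, auxP_eval, auxP_eval,
      show a + 1 + -(c + b + 1 + k) = 1 - (c + b - a + 1) - k by ring,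
      show b + 1 + -(c + b + 1 + k) = 1 - (c + 1) - k by ring, aux_reflect, aux_reflect]
    have : ((-1 : ℝ) ^ k) * (-1) ^ k = 1 := by rw [← mul_pow]; simp
    linear_combination (poch (c + b - a + 1) k * poch (c + 1) k) * this
  have p1 := (aux_poch_pos _ hs k).ne'
  have p2 := (aux_poch_pos _ hs (3 * k)).ne'
  have p3 := (aux_poch_pos (c + b + 2) (by linarith) (3 * k)).ne'
  have p4 := (aux_poch_pos (c + b + 1 + k) (by positivity) (2 * k + 1)).ne'
  have h5 : poch (c + b + 1) k * poch (c + b + 1 + k) (2 * k + 1) =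
      (c + b + 1) * poch (c + b + 2) (3 * k) := by
    rw [← aux_poch_add, show k + (2 * k + 1) = 1 + 3 * k by ring, aux_poch_add]
    simp only [poch, Finset.prod_range_one, Nat.cast_zero, add_zero, Nat.cast_one]
    rw [show c + b + 1 + 1 = c + b + 2 by ring]
  trans poch (a + 1) (2 * k) * poch (b + 1) (2 * k) * (c + b + 1) / poch (c + b + 1) (3 * k) *
    (poch (c + b - a + 1) k * poch (c + 1) k *
      ((-1) ^ (2 * k) * (2 * k).factorial / poch (c + b + 1 + k) (2 * k + 1)))
  · rw [← hv, ← h, Finset.mul_sum]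
    refine Finset.sum_congr rfl fun j hj => ?_
    have hj : j ≤ 2 * k := Nat.lt_succ_iff.1 (Finset.mem_range.1 hj)
    have hA := aux_combine (a + 1) k (2 * k) j hj
    have hB := aux_combine (b + 1) k (2 * k) j hj
    have hC := aux_poch_add (c + b + 1) (k + j) (2 * k - j)
    rw [show k + j + (2 * k - j) = 3 * k by omega] at hC
    push_cast at hC
    rw [← add_assoc] at hC
    have hD : (c + b + 1) * poch (c + 1 + b + 1) (k + j) =
        poch (c + b + 1) (k + j) * (c + b + 1 + k + j) := by
      have e1 := aux_poch_add (c + b + 1) 1 (k + j)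
      have e2 := aux_poch_add (c + b + 1) (k + j) 1
      rw [add_comm 1 (k + j), e2] at e1
      simp only [poch, Finset.prod_range_one, Nat.cast_zero, add_zero, Nat.cast_one] at e1 ⊢
      rw [show c + 1 + b + 1 = c + b + 1 + 1 by ring, ← e1]
      push_cast; ring
    have q1 := (aux_poch_pos _ hs (k + j)).ne'
    have q2 := (aux_poch_pos (c + b + 1 + k + j) (by positivity) (2 * k - j)).ne'
    have q3 : c + b + 1 + k + j ≠ 0 := by positivity
    have q4 := hs.ne'
    have hD' : poch (c + 1 + b + 1) (k + j) =
        poch (c + b + 1) (k + j) * (c + b + 1 + k + j) / (c + b + 1) := by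
      rw [eq_div_iff q4, ← hD]; ring
    rw [show (2 * k + 1) / 2 = k by omega, eval_mul, auxP_eval, auxP_eval, hC, hD']
    calc _ = (-1 : ℝ) ^ (2 * k - j) * ((2 * k).choose j : ℝ) *
        ((poch (a + 1 + j) (2 * k - j) * poch (a + 1) (k + j)) *
          (poch (b + 1 + j) (2 * k - j) * poch (b + 1) (k + j))) * (c + b + 1) /
        (poch (c + b + 1) (k + j) * poch (c + b + 1 + k + j) (2 * k - j) *
          (c + b + 1 + k + j)) := by
          field_simp
      _ = _ := by rw [hA, hB]; field_simp
  · rw [pow_mul, neg_one_sq, one_pow, one_mul]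
    have h6 : poch (c + b + 2) (3 * k) =
        poch (c + b + 1) k * poch (c + b + 1 + k) (2 * k + 1) / (c + b + 1) := by
      rw [eq_div_iff hs.ne', h5]; ring
    rw [h6]
    have := hs.ne'
    field_simp

theorem normalization_even (a b c : ℝ) (ha : a > -1) (hb : b > -1)
    (hc : c > max 0 (a - b)) (k : ℕ) :
    (∫ x in Set.Ioi (0:ℝ), x ^ k * Ptype2 0 a b c (2 * k) x * W a b c x
      = (2 * k).factorial * poch (a + 1) (2 * k) * poch (b + 1) (2 * k) /
          poch (c + b + 1) (3 * k)) ∧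
    (∫ x in Set.Ioi (0:ℝ), x ^ k * Ptype2 1 a b c (2 * k) x * W a b (c + 1) x
      = (2 * k).factorial * poch (a + 1) (2 * k) * poch (b + 1) (2 * k) *
          poch (c + b - a + 1) k * poch (c + 1) k * poch (c + b + 1) k /
          (poch (c + b + 1) (3 * k) * poch (c + b + 2) (3 * k))) ∧
    0 < ∫ x in Set.Ioi (0:ℝ), x ^ k * Ptype2 0 a b c (2 * k) x * W a b c x ∧
    0 < ∫ x in Set.Ioi (0:ℝ), x ^ k * Ptype2 1 a b c (2 * k) x * W a b (c + 1) x := by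
  have hc0 : 0 < c := lt_of_le_of_lt (le_max_left _ _) hc
  have hc1 : a - b < c := lt_of_le_of_lt (le_max_right _ _) hc
  have h1 := aux_even a b c ha hb hc0 k
  have h2 := aux_odd a b c ha hb hc0 k
  have q1 := aux_poch_pos (a + 1) (by linarith) (2 * k)
  have q2 := aux_poch_pos (b + 1) (by linarith) (2 * k)
  have q3 := aux_poch_pos (c + b - a + 1) (by linarith) k
  have q4 := aux_poch_pos (c + 1) (by linarith) k
  have q5 := aux_poch_pos (c + b + 1) (by linarith) k
  have q6 := aux_poch_pos (c + b + 1) (by linarith) (3 * k)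
  have q7 := aux_poch_pos (c + b + 2) (by linarith) (3 * k)
  refine ⟨h1, h2, ?_, ?_⟩
  · rw [h1]; positivity
  · rw [h2]; positivity
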